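/- Let n ≥ 1 and let φ: [0,1]×ℝ^{2n} → ℝ^{2n} and F: [0,1]×ℝ^{2n} → ℝ be C² in (t,x), with each φ_t = φ(t,·) a diffeomorphism of ℝ^{2n}, such that: (i) for all t, x, y, (∂F_t/∂x)(x)·y = ½ω(φ_t(x), (∂φ_t/∂x)(x)·y) − ½ω(x,y) (the lift condition for volume preserving diffeomorphisms of H(n)); and (ii) for all t, x, (∂F/∂t)(t,x) = ½ω(φ_t(x), (∂φ/∂t)(t,x)) (horizontality of the flow of lifts). Then the flow is constant: (∂φ/∂t)(t,x) = 0 for all t and x. -/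

import Mathlib

open Filter Topology Set MeasureTheory

noncomputable section

/-- The underlying space `ℝ^{2n}` of the horizontal part of the Heisenberg group. -/
abbrev Epl (n : ℕ) := EuclideanSpace ℝ (Fin (2 * n))

def idxA {n : ℕ} (i : Fin n) : Fin (2 * n) := ⟨i, by have := i.isLt; omega⟩
def idxB {n : ℕ} (i : Fin n) : Fin (2 * n) := ⟨n + i, by have := i.isLt; omega⟩

/-- The standard symplectic form on `ℝ^{2n}`:
`ω(x,y) = Σ_i (x_i y_{n+i} - x_{n+i} y_i)`. -/
def omegaForm {n : ℕ} (x y : Epl n) : ℝ :=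
  ∑ i : Fin n, (x (idxA i) * y (idxB i) - x (idxB i) * y (idxA i))

/-- A point of the Heisenberg group `H(n) = ℝ^{2n} × ℝ`. -/
abbrev Hpt (n : ℕ) := Epl n × ℝ

/-- Heisenberg group multiplication `(x,x̄)·(y,ȳ) = (x+y, x̄+ȳ+½ω(x,y))`. -/
def hMul {n : ℕ} (p q : Hpt n) : Hpt n :=
  (p.1 + q.1, p.2 + q.2 + (1 / 2) * omegaForm p.1 q.1)

/-- Heisenberg group inverse. -/
def hInv {n : ℕ} (p : Hpt n) : Hpt n := (-p.1, -p.2)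

/-- Heisenberg dilatation `δ_ε(x,x̄) = (εx, ε²x̄)`. -/
def hDil {n : ℕ} (ε : ℝ) (p : Hpt n) : Hpt n := (ε • p.1, ε ^ 2 * p.2)

/-- `γ'` is an a.e. derivative of the horizontal Lipschitz curve `(γ, γb)` on `[0,1]`:
a.e. `γ` has derivative `γ' t` and `γb` has derivative `½ ω(γ t, γ' t)`. -/
def IsHorizontalLift {n : ℕ} (γ : ℝ → Epl n) (γb : ℝ → ℝ) (γ' : ℝ → Epl n) : Prop :=
  ∀ᵐ t ∂(volume.restrict (Set.Icc (0 : ℝ) 1)),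
    HasDerivAt γ (γ' t) t ∧ HasDerivAt γb ((1 / 2) * omegaForm (γ t) (γ' t)) t

/-- The Carnot–Carathéodory distance on the Heisenberg group `H(n)`:
the infimum of `∫₀¹ ‖γ'(t)‖ dt` over horizontal Lipschitz curves joining the points. -/
def ccDist (n : ℕ) (p q : Hpt n) : ℝ :=
  sInf {L : ℝ | ∃ (γ : ℝ → Epl n) (γb : ℝ → ℝ) (γ' : ℝ → Epl n) (K : NNReal),
    LipschitzOnWith K (fun t => ((γ t, γb t) : Hpt n)) (Set.Icc 0 1) ∧
    (γ 0, γb 0) = p ∧ (γ 1, γb 1) = q ∧ IsHorizontalLift γ γb γ' ∧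
    L = ∫ t in (0 : ℝ)..1, ‖γ' t‖}

theorem idxA_injective {n : ℕ} : Function.Injective (idxA (n := n)) := fun i j h => by
  simpa [idxA, Fin.ext_iff] using h

theorem idxB_injective {n : ℕ} : Function.Injective (idxB (n := n)) := fun i j h => by
  simpa [idxB, Fin.ext_iff] using h

theorem idxA_ne_idxB {n : ℕ} (i j : Fin n) : idxA i ≠ idxB j := fun h => by
  have := i.isLt
  simp only [idxA, idxB, Fin.ext_iff] at h
  omega

theorem omegaForm_swap {n : ℕ} (x y : Epl n) : omegaForm y x = -omegaForm x y := by
  simp only [omegaForm, ← Finset.sum_neg_distrib]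
  exact Finset.sum_congr rfl fun i _ => by ring

/-- The standard symplectic form as a continuous bilinear map. -/
def omegaBilin (n : ℕ) : Epl n →L[ℝ] Epl n →L[ℝ] ℝ :=
  (LinearMap.mk₂ ℝ omegaForm
    (fun x y z => by
      simp only [omegaForm, PiLp.add_apply, ← Finset.sum_add_distrib]
      exact Finset.sum_congr rfl fun i _ => by ring)
    (fun c x y => by
      simp only [omegaForm, PiLp.smul_apply, smul_eq_mul, Finset.mul_sum]
      exact Finset.sum_congr rfl fun i _ => by ring)
    (fun x y z => by
      simp only [omegaForm, PiLp.add_apply, ← Finset.sum_add_distrib]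
      exact Finset.sum_congr rfl fun i _ => by ring)
    (fun c x y => by
      simp only [omegaForm, PiLp.smul_apply, smul_eq_mul, Finset.mul_sum]
      exact Finset.sum_congr rfl fun i _ => by ring)).toContinuousBilinearMap

@[simp]
theorem omegaBilin_apply {n : ℕ} (x y : Epl n) : omegaBilin n x y = omegaForm x y := rfl

theorem omegaForm_single_idxB {n : ℕ} (x : Epl n) (i : Fin n) :
    omegaForm x (EuclideanSpace.single (idxB i) 1) = x (idxA i) := by
  simp [omegaForm, idxA_ne_idxB, idxB_injective.eq_iff]

theorem omegaForm_single_idxA {n : ℕ} (x : Epl n) (i : Fin n) :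
    omegaForm x (EuclideanSpace.single (idxA i) 1) = -x (idxB i) := by
  simp [omegaForm, (idxA_ne_idxB _ _).symm, idxA_injective.eq_iff]

theorem eq_zero_of_omegaForm_eq_zero {n : ℕ} {x : Epl n} (h : ∀ y, omegaForm x y = 0) :
    x = 0 := by
  ext k
  by_cases hk : (k : ℕ) < n
  · simpa [omegaForm_single_idxB, idxA] using h (EuclideanSpace.single (idxB ⟨k, hk⟩) 1)
  · have hlt : (k : ℕ) - n < n := by have := k.isLt; omega
    have hB : idxB ⟨(k : ℕ) - n, hlt⟩ = k := by
      simp only [idxB, Fin.ext_iff]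
      omega
    simpa [omegaForm_single_idxA, hB] using
      h (EuclideanSpace.single (idxA ⟨(k : ℕ) - n, hlt⟩) 1)

/-- An endomorphism preserving the symplectic form is surjective. -/
theorem surjective_of_omegaForm_map {n : ℕ} (L : Epl n →ₗ[ℝ] Epl n)
    (hL : ∀ x y, omegaForm (L x) (L y) = omegaForm x y) : Function.Surjective L := by
  refine LinearMap.injective_iff_surjective.1 ((injective_iff_map_eq_zero L).2 fun x hx => ?_)
  refine eq_zero_of_omegaForm_eq_zero fun y => ?_
  rw [← hL, hx, ← omegaBilin_apply, map_zero, zero_apply]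

/-- If `dG = ½ ω(Ψ, dΨ) - ½ ω(π, dπ)` near `p` for a continuous linear map `π`,
then `Ψ^* ω = π^* ω` at `p`. -/
theorem omegaForm_fderiv_eq_of_primitive {n : ℕ} {V : Type*} [NormedAddCommGroup V]
    [NormedSpace ℝ V] {Ψ : V → Epl n} {G : V → ℝ} {π : V →L[ℝ] Epl n} {p : V}
    (hΨ : ContDiffAt ℝ 2 Ψ p) (hG : ContDiffAt ℝ 2 G p)
    (h : ∀ᶠ q in 𝓝 p, ∀ v, fderiv ℝ G q v =
      (1 / 2) * omegaForm (Ψ q) (fderiv ℝ Ψ q v) - (1 / 2) * omegaForm (π q) (π v))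
    (w v : V) :
    omegaForm (fderiv ℝ Ψ p w) (fderiv ℝ Ψ p v) = omegaForm (π w) (π v) := by
  have hsΨ : IsSymmSndFDerivAt ℝ Ψ p := hΨ.isSymmSndFDerivAt (by simp)
  have hsG : IsSymmSndFDerivAt ℝ G p := hG.isSymmSndFDerivAt (by simp)
  have hdΨ : HasFDerivAt Ψ (fderiv ℝ Ψ p) p := (hΨ.differentiableAt (by simp)).hasFDerivAt
  have hddΨ : HasFDerivAt (fderiv ℝ Ψ) (fderiv ℝ (fderiv ℝ Ψ) p) p :=
    ((hΨ.fderiv_right (m := 1) (by norm_num)).differentiableAt (by simp)).hasFDerivAt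
  have hddG : HasFDerivAt (fderiv ℝ G) (fderiv ℝ (fderiv ℝ G) p) p :=
    ((hG.fderiv_right (m := 1) (by norm_num)).differentiableAt (by simp)).hasFDerivAt
  have key : ∀ w v, fderiv ℝ (fderiv ℝ G) p w v =
      (1 / 2) * (omegaForm (Ψ p) (fderiv ℝ (fderiv ℝ Ψ) p w v) +
        omegaForm (fderiv ℝ Ψ p w) (fderiv ℝ Ψ p v)) - (1 / 2) * omegaForm (π w) (π v) := by
    intro w v
    have hGv := hddG.clm_apply (hasFDerivAt_const v p)
    have hΨv := (omegaBilin n).hasFDerivAt_of_bilinear hdΨ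
      (hddΨ.clm_apply (hasFDerivAt_const v p))
    have hπv := (omegaBilin n).hasFDerivAt_of_bilinear π.hasFDerivAt
      (hasFDerivAt_const (π v) p)
    have hR := ((hΨv.const_mul (1 / 2)).sub (hπv.const_mul (1 / 2))).congr_of_eventuallyEq
      (f₁ := fun q => fderiv ℝ G q v) (by filter_upwards [h] with q hq using hq v)
    simpa [mul_add] using DFunLike.congr_fun (hGv.unique hR) w
  have h₁ := key w v
  have h₂ := key v w
  rw [hsG.eq v w, hsΨ.eq v w, omegaForm_swap (fderiv ℝ Ψ p w), omegaForm_swap (π w)] at h₂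
  linarith

/-- The derivative of a function of two variables in terms of its partial derivatives. -/
theorem fderiv_apply_eq_deriv_add_fderiv {E E' : Type*} [NormedAddCommGroup E]
    [NormedSpace ℝ E] [NormedAddCommGroup E'] [NormedSpace ℝ E'] {f : ℝ → E → E'} {t : ℝ} {x : E}
    (hf : DifferentiableAt ℝ (fun p : ℝ × E => f p.1 p.2) (t, x)) (v : ℝ × E) :
    fderiv ℝ (fun p : ℝ × E => f p.1 p.2) (t, x) v =
      v.1 • deriv (fun s => f s x) t + fderiv ℝ (f t) x v.2 := by
  set D := fderiv ℝ (fun p : ℝ × E => f p.1 p.2) (t, x)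
  have h₁ : HasDerivAt (fun s => f s x) (D (1, 0)) t :=
    hf.hasFDerivAt.comp_hasDerivAt (f := fun s => (s, x)) t
      ((hasDerivAt_id' t).prodMk (hasDerivAt_const t x))
  have h₂ : HasFDerivAt (f t) (D.comp (ContinuousLinearMap.inr ℝ ℝ E)) x :=
    hf.hasFDerivAt.comp (f := fun y => (t, y)) x (hasFDerivAt_prodMk_right t x)
  rw [h₁.deriv, h₂.fderiv, ← map_smul]
  simp [← map_add]

/-- A `C²` flow `t ↦ φ̃_t`, `φ̃_t(x,x̄) = (φ_t(x), x̄ + F_t(x))`, of volume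
preserving diffeomorphisms of the Heisenberg group `H(n)` (hypothesis `hlift`)
all of whose trajectories are horizontal curves (hypothesis `hhoriz`) is
constant: `∂φ/∂t = 0`. -/
theorem heisenberg_horizontal_flow_is_constant (n : ℕ) (hn : 1 ≤ n)
    (φ : ℝ → Epl n → Epl n) (F : ℝ → Epl n → ℝ)
    (hφ : ContDiffOn ℝ 2 (fun p : ℝ × Epl n => φ p.1 p.2) (Set.Icc 0 1 ×ˢ Set.univ))
    (hF : ContDiffOn ℝ 2 (fun p : ℝ × Epl n => F p.1 p.2) (Set.Icc 0 1 ×ˢ Set.univ))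
    (hdiffeo : ∀ t ∈ Set.Icc (0 : ℝ) 1, Function.Bijective (φ t))
    (hlift : ∀ t ∈ Set.Icc (0 : ℝ) 1, ∀ x y : Epl n,
      fderiv ℝ (F t) x y =
        (1 / 2) * omegaForm (φ t x) (fderiv ℝ (φ t) x y) - (1 / 2) * omegaForm x y)
    (hhoriz : ∀ t ∈ Set.Icc (0 : ℝ) 1, ∀ x : Epl n,
      derivWithin (fun s => F s x) (Set.Icc 0 1) t =
        (1 / 2) * omegaForm (φ t x) (derivWithin (fun s => φ s x) (Set.Icc 0 1) t)) :
    ∀ t ∈ Set.Icc (0 : ℝ) 1, ∀ x : Epl n,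
      derivWithin (fun s => φ s x) (Set.Icc 0 1) t = 0 := by
  have hint : ∀ t ∈ Set.Ioo (0 : ℝ) 1, Set.Icc (0 : ℝ) 1 ∈ 𝓝 t := fun t ht =>
    Icc_mem_nhds ht.1 ht.2
  have hnhds : ∀ t ∈ Set.Ioo (0 : ℝ) 1, ∀ x : Epl n,
      Set.Icc (0 : ℝ) 1 ×ˢ Set.univ ∈ 𝓝 (t, x) := fun t ht x =>
    prod_mem_nhds (hint t ht) univ_mem
  have hcφ : ∀ t ∈ Set.Ioo (0 : ℝ) 1, ∀ x, ContDiffAt ℝ 2 (fun p : ℝ × Epl n => φ p.1 p.2) (t, x) :=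
    fun t ht x => hφ.contDiffAt (hnhds t ht x)
  have hcF : ∀ t ∈ Set.Ioo (0 : ℝ) 1, ∀ x,
      ContDiffAt ℝ 2 (fun p : ℝ × Epl n => F p.1 p.2) (t, x) :=
    fun t ht x => hF.contDiffAt (hnhds t ht x)
  have hdφ := fun t ht x => fderiv_apply_eq_deriv_add_fderiv
    ((hcφ t ht x).differentiableAt (by simp))
  have hdF := fun t ht x => fderiv_apply_eq_deriv_add_fderiv
    ((hcF t ht x).differentiableAt (by simp))
  have hprim : ∀ t ∈ Set.Ioo (0 : ℝ) 1, ∀ x v,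
      fderiv ℝ (fun p : ℝ × Epl n => F p.1 p.2) (t, x) v =
        (1 / 2) * omegaForm (φ t x) (fderiv ℝ (fun p : ℝ × Epl n => φ p.1 p.2) (t, x) v) -
          (1 / 2) * omegaForm x v.2 := by
    intro t ht x v
    have hh := hhoriz t (Ioo_subset_Icc_self ht) x
    rw [derivWithin_of_mem_nhds (hint t ht), derivWithin_of_mem_nhds (hint t ht)] at hh
    rw [hdF t ht x, hdφ t ht x, hh, hlift t (Ioo_subset_Icc_self ht)]
    simp only [← omegaBilin_apply, map_add, map_smul, smul_eq_mul]
    ring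
  have hpull : ∀ t ∈ Set.Ioo (0 : ℝ) 1, ∀ x, ∀ w v : ℝ × Epl n,
      omegaForm (w.1 • deriv (fun s => φ s x) t + fderiv ℝ (φ t) x w.2)
        (v.1 • deriv (fun s => φ s x) t + fderiv ℝ (φ t) x v.2) = omegaForm w.2 v.2 := by
    intro t ht x w v
    rw [← hdφ t ht x, ← hdφ t ht x]
    refine omegaForm_fderiv_eq_of_primitive (π := ContinuousLinearMap.snd ℝ ℝ (Epl n))
      (hcφ t ht x) (hcF t ht x) ?_ w v
    filter_upwards [prod_mem_nhds (isOpen_Ioo.mem_nhds ht) univ_mem] with q hq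
    exact hprim q.1 hq.1 q.2
  have hzero : ∀ t ∈ Set.Ioo (0 : ℝ) 1, ∀ x, deriv (fun s => φ s x) t = 0 := by
    intro t ht x
    have hsurj := surjective_of_omegaForm_map (fderiv ℝ (φ t) x : Epl n →ₗ[ℝ] Epl n)
      fun y z => by simpa using hpull t ht x (0, y) (0, z)
    refine eq_zero_of_omegaForm_eq_zero fun z => ?_
    obtain ⟨y, rfl⟩ := hsurj z
    simpa [← omegaBilin_apply] using hpull t ht x (1, 0) (0, y)
  intro t ht x
  have hx : ContDiffOn ℝ 2 (fun s => φ s x) (Set.Icc 0 1) :=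
    hφ.comp (contDiffOn_id.prodMk contDiffOn_const) fun s hs => ⟨hs, mem_univ x⟩
  have heq : EqOn (derivWithin (fun s => φ s x) (Set.Icc 0 1)) 0 (Set.Ioo 0 1) := fun s hs => by
    rw [derivWithin_of_mem_nhds (hint s hs), hzero s hs x, Pi.zero_apply]
  exact heq.of_subset_closure
    (hx.continuousOn_derivWithin (uniqueDiffOn_Icc zero_lt_one) (by norm_num)) continuousOn_const
    Ioo_subset_Icc_self (closure_Ioo zero_ne_one).ge ht
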